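/- Let λ, ℓ : ℕ and let G : BitVec λ → BitVec (3·λ) be injective. If the commitment key s : Fin ℓ → BitVec (3·λ) is drawn from the uniform distribution on the finite type Fin ℓ → BitVec (3·λ) (equivalently, each coordinate s i is independent and uniform on BitVec (3·λ)), then the probability that the commitment map (m, r) ↦ (i ↦ G (r i) ^^^ (if m i then s i else 0)) fails to be injective on (Fin ℓ → Bool) × (Fin ℓ → BitVec λ) is at most ℓ · (1/2)^λ. -/

import Mathlib

instance (n : ℕ) : Fintype (BitVec n) :=
  Fintype.ofEquiv (Fin (2 ^ n)) ⟨BitVec.ofFin, BitVec.toFin, fun _ => rfl, fun _ => rfl⟩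

open scoped ENNReal

/-- Under the uniform distribution on functions `ι → α`, each coordinate is uniform on `α`. -/
theorem PMF.toOuterMeasure_uniformOfFintype_eval_mem {ι α : Type*} [Fintype ι] [DecidableEq ι]
    [Fintype α] [Nonempty α] (i : ι) (T : Finset α) :
    (PMF.uniformOfFintype (ι → α)).toOuterMeasure {s | s i ∈ T} =
      (T.card : ℝ≥0∞) / Fintype.card α := by
  classical
  have hset : {s : ι → α | s i ∈ T} =
      (Fintype.piFinset (Function.update (fun _ => Finset.univ) i T) : Finset (ι → α)) := by
    ext s
    simp only [Set.mem_ofPred_eq, Finset.mem_coe, Fintype.mem_piFinset]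
    refine ⟨fun h j => ?_, fun h => by simpa using h i⟩
    rcases eq_or_ne j i with rfl | hj
    · simpa using h
    · simp [hj]
  have hcard : (Fintype.piFinset (Function.update (fun _ => Finset.univ) i T) : Finset (ι → α)).card =
      T.card * Fintype.card α ^ (Fintype.card ι - 1) := by
    rw [Fintype.card_piFinset, ← Finset.mul_prod_erase _ _ (Finset.mem_univ i),
      Finset.prod_congr rfl (g := fun _ => Fintype.card α)]
    · simp
    · intro j hj
      simp [Finset.ne_of_mem_erase hj]
  have hι : Fintype.card (ι → α) =
      Fintype.card α * Fintype.card α ^ (Fintype.card ι - 1) := by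
    rw [Fintype.card_fun, mul_pow_sub_one (Fintype.card_pos_iff.2 ⟨i⟩).ne']
  rw [hset, PMF.toOuterMeasure_uniformOfFintype_apply, hι, ← Nat.card_eq_fintype_card,
    Nat.card_coe_set_eq, Set.ncard_coe_finset, hcard]
  push_cast
  exact ENNReal.mul_div_mul_right _ _ (by simp) (by finiteness)

/-- If no coordinate of the key is of the form `G r ^^^ G r'`, the commitment map is injective. -/
theorem naor_commitment_injective {ι : Type*} {l k : ℕ} {G : BitVec l → BitVec k}
    (hG : Function.Injective G) {s : ι → BitVec k} (hs : ∀ i r r', G r ^^^ G r' ≠ s i) :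
    Function.Injective (fun p : (ι → Bool) × (ι → BitVec l) =>
      fun i : ι => G (p.2 i) ^^^ (if p.1 i then s i else 0)) := by
  rintro ⟨m, r⟩ ⟨m', r'⟩ h
  have key (i : ι) : m i = m' i ∧ r i = r' i := by
    have hi := congrFun h i
    cases hm : m i <;> cases hm' : m' i <;> simp [hm, hm'] at hi ⊢
    · exact hG hi
    · exact hs i (r' i) (r i) (by rw [hi, ← BitVec.xor_assoc]; simp)
    · exact hs i (r i) (r' i) (by rw [← hi, ← BitVec.xor_assoc]; simp)
    · exact hG hi
  exact Prod.ext (funext fun i => (key i).1) (funext fun i => (key i).2)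

theorem naor_commitment_injectivity_prob (l L : ℕ) (G : BitVec l → BitVec (3 * l))
    (hG : Function.Injective G) :
    (PMF.uniformOfFintype (Fin L → BitVec (3 * l))).toOuterMeasure
        {s : Fin L → BitVec (3 * l) |
          ¬ Function.Injective (fun p : (Fin L → Bool) × (Fin L → BitVec l) =>
              fun i : Fin L => G (p.2 i) ^^^ (if p.1 i then s i else 0))}
      ≤ (L : ENNReal) * (1 / 2 : ENNReal) ^ l := by
  classical
  let T : Finset (BitVec (3 * l)) :=
    Finset.univ.image fun p : BitVec l × BitVec l => G p.1 ^^^ G p.2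
  have card_bitVec (n : ℕ) : Fintype.card (BitVec n) = 2 ^ n := by
    simpa using Fintype.card_congr
      (⟨BitVec.toFin, BitVec.ofFin, fun _ => rfl, fun _ => rfl⟩ : BitVec n ≃ Fin (2 ^ n))
  have hT : T.card ≤ 2 ^ (2 * l) := by
    refine Finset.card_image_le.trans_eq ?_
    rw [Finset.card_univ, Fintype.card_prod, card_bitVec, two_mul, pow_add]
  have hcoord : (T.card : ℝ≥0∞) / Fintype.card (BitVec (3 * l)) ≤ (1 / 2) ^ l := by
    rw [card_bitVec]
    refine ENNReal.div_le_of_le_mul ?_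
    have hpow : (1 / 2 : ℝ≥0∞) ^ l * ((2 ^ (3 * l) : ℕ) : ℝ≥0∞) = ((2 ^ (2 * l) : ℕ) : ℝ≥0∞) := by
      push_cast
      rw [show 3 * l = l + 2 * l by ring, pow_add, ← mul_assoc, ← mul_pow, one_div,
        ENNReal.inv_mul_cancel (by simp) (by simp), one_pow, one_mul]
    rw [hpow]
    exact_mod_cast hT
  calc
    _ ≤ (PMF.uniformOfFintype (Fin L → BitVec (3 * l))).toOuterMeasure
          (⋃ i, {s | s i ∈ T}) := by
      refine MeasureTheory.measure_mono fun s hs => ?_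
      by_contra hmem
      refine hs (naor_commitment_injective hG fun i r r' h => hmem ?_)
      exact Set.mem_iUnion.2 ⟨i, Finset.mem_image.2 ⟨(r, r'), Finset.mem_univ _, h⟩⟩
    _ ≤ ∑ i, (PMF.uniformOfFintype (Fin L → BitVec (3 * l))).toOuterMeasure {s | s i ∈ T} :=
      MeasureTheory.measure_iUnion_fintype_le _ _
    _ ≤ ∑ _i : Fin L, (1 / 2 : ℝ≥0∞) ^ l := by
      refine Finset.sum_le_sum fun i _ => ?_
      rw [PMF.toOuterMeasure_uniformOfFintype_eval_mem]
      exact hcoord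
    _ = _ := by simp
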